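/- arXiv:2507.11827 — 3 statements merged into one kernel-verified Lean document; each statement's English description precedes it below -/
import Mathlib

section
/- Soundness of the split relaxation (Theorem C.1): Let n, m be natural numbers, let K_1, …, K_n be nonempty subsets of ℝ and K = K_1 × ⋯ × K_n ⊆ ℝ^n. Let f(v) = ∑_{1≤i<k≤n} H_{ik} v_i v_k + ∑_{i=1}^n Q_i v_i² + cᵀv + d be a quadratic objective, A ∈ ℝ^{m×n}, b ∈ ℝ^m. For λ ∈ ℝ^m with λ ≥ 0 componentwise, a vector S ∈ ℝ^n, and reals D^i_{ik}, D^k_{ik} for each pair i < k, define Δ ∈ ℝ^n as the coordinatewise sum of the D-coefficients attached to each variable, and define (in the extended reals) ĝ(λ, S, D) = ∑_{i<k} inf_{(x,y) ∈ K_i × K_k} (H_{ik} x y + D^i_{ik} x + D^k_{ik} y) + ∑_{i=1}^n inf_{x ∈ K_i} (Q_i x² + S_i x) + inf_{v ∈ K} (c + Aᵀλ − S − Δ)ᵀ v + d − λᵀ b. Then ĝ(λ, S, D) ≤ inf { f(v) | v ∈ K, A v ≤ b }, where the right-hand infimum is taken in the extended reals. -/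
open Matrix Finset

/-- The coefficients `D1 i k` and `D2 i k`, attached to the two ends of each pair `i < k`, regroup
by variable. -/
theorem sum_pairs_eq_dotProduct {ι : Type*} [Fintype ι] [LinearOrder ι]
    (D1 D2 : ι → ι → ℝ) (v : ι → ℝ) :
    ∑ p ∈ univ.filter (fun p : ι × ι => p.1 < p.2), (D1 p.1 p.2 * v p.1 + D2 p.1 p.2 * v p.2)
      = (fun i => (∑ k ∈ univ.filter (fun k => i < k), D1 i k)
          + ∑ k ∈ univ.filter (fun k => k < i), D2 k i) ⬝ᵥ v := by
  simp only [dotProduct, add_mul, sum_mul, sum_add_distrib, sum_filter, Fintype.sum_prod_type,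
    ite_mul, zero_mul]
  congr 1
  exact Finset.sum_comm

/-- Weak duality for the linear constraints. -/
theorem transpose_mulVec_dotProduct_le {ι κ : Type*} [Fintype ι] [Fintype κ]
    (A : Matrix κ ι ℝ) {b lam : κ → ℝ} {v : ι → ℝ} (hlam : 0 ≤ lam) (hv : A.mulVec v ≤ b) :
    A.transpose.mulVec lam ⬝ᵥ v ≤ lam ⬝ᵥ b := by
  rw [mulVec_transpose, ← dotProduct_mulVec]
  exact dotProduct_le_dotProduct_of_nonneg_left hv hlam

/-- The coercion from the reals to the extended reals commutes with finite sums. -/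
theorem ereal_coe_sum {ι : Type*} (s : Finset ι) (f : ι → ℝ) :
    ((∑ i ∈ s, f i : ℝ) : EReal) = ∑ i ∈ s, (f i : EReal) :=
  map_sum (⟨⟨Real.toEReal, rfl⟩, EReal.coe_add⟩ : ℝ →+ EReal) f s

/-- Soundness of the split relaxation (Theorem C.1): for nonnegative multipliers `lam`
and arbitrary splitting parameters `S`, `D1`, `D2` (with aggregate `Δ`), the relaxed
value `ĝ(lam, S, D)` — the sum of independent infima of the bilinear, quadratic, and
residual linear parts over the box `K = K_1 × ⋯ × K_n` — is a lower bound (in the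
extended reals) on the constrained minimum of the quadratic objective. -/
theorem split_relaxation_sound
    (n m : ℕ) (K : Fin n → Set ℝ) (hK : ∀ i, (K i).Nonempty)
    (H D1 D2 : Fin n → Fin n → ℝ) (Q c S Δ : Fin n → ℝ) (d : ℝ)
    (A : Matrix (Fin m) (Fin n) ℝ) (b lam : Fin m → ℝ) (hlam : 0 ≤ lam)
    (hΔ : ∀ i, Δ i = (∑ k ∈ Finset.univ.filter (fun k => i < k), D1 i k)
        + ∑ k ∈ Finset.univ.filter (fun k => k < i), D2 k i) :
    (∑ p ∈ Finset.univ.filter (fun p : Fin n × Fin n => p.1 < p.2),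
        ⨅ x ∈ K p.1, ⨅ y ∈ K p.2,
          ((H p.1 p.2 * x * y + D1 p.1 p.2 * x + D2 p.1 p.2 * y : ℝ) : EReal))
      + (∑ i, ⨅ x ∈ K i, ((Q i * x ^ 2 + S i * x : ℝ) : EReal))
      + (⨅ v ∈ {v : Fin n → ℝ | ∀ i, v i ∈ K i},
          (((c + A.transpose.mulVec lam - S - Δ) ⬝ᵥ v : ℝ) : EReal))
      + ((d - lam ⬝ᵥ b : ℝ) : EReal)
    ≤ ⨅ v ∈ {v : Fin n → ℝ | (∀ i, v i ∈ K i) ∧ A.mulVec v ≤ b},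
        (((∑ p ∈ Finset.univ.filter (fun p : Fin n × Fin n => p.1 < p.2),
            H p.1 p.2 * v p.1 * v p.2)
          + (∑ i, Q i * v i ^ 2) + c ⬝ᵥ v + d : ℝ) : EReal) := by
  refine le_iInf₂ fun v hv => ?_
  obtain ⟨hvK, hvA⟩ := hv
  refine (add_le_add_left (add_le_add (add_le_add
    (sum_le_sum fun p _ => iInf₂_le_of_le (v p.1) (hvK p.1) (iInf₂_le (v p.2) (hvK p.2)))
    (sum_le_sum fun i _ => iInf₂_le (v i) (hvK i))) (iInf₂_le v hvK)) _).trans ?_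
  rw [← ereal_coe_sum, ← ereal_coe_sum, ← EReal.coe_add, ← EReal.coe_add, ← EReal.coe_add,
    EReal.coe_le_coe_iff]
  have hD := sum_pairs_eq_dotProduct D1 D2 v
  rw [← funext hΔ] at hD
  have hA := transpose_mulVec_dotProduct_le A hlam hvA
  have hS : ∑ i, S i * v i = S ⬝ᵥ v := rfl
  simp only [add_assoc, sum_add_distrib, sub_dotProduct, add_dotProduct] at hD ⊢
  linarith
end

section
/- Strong LP duality in attained multiplier form: Let A ∈ ℝ^{m×n}, b ∈ ℝ^m, c ∈ ℝ^n. Suppose the primal feasible set {x ∈ ℝ^n | A x ≤ b} is nonempty and the infimum o of cᵀx over this set is finite. Then there exists y ∈ ℝ^m with y ≥ 0 componentwise, Aᵀy = −c, and −bᵀy = o. -/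
open Matrix

/-- **Farkas' lemma** for finitely many linear functionals on an arbitrary vector space: if `g` is
nonpositive wherever all `f i`, `i ∈ s`, are, then `g` is a nonnegative combination of them. -/
theorem exists_nonneg_sum_smul_eq_of_forall_nonpos {𝕜 V ι : Type*} [Field 𝕜] [LinearOrder 𝕜]
    [IsStrictOrderedRing 𝕜] [AddCommGroup V] [Module 𝕜 V] (s : Finset ι)
    (f : ι → V →ₗ[𝕜] 𝕜) (g : V →ₗ[𝕜] 𝕜)
    (h : ∀ x, (∀ i ∈ s, f i x ≤ 0) → g x ≤ 0) :
    ∃ y : ι → 𝕜, 0 ≤ y ∧ ∑ i ∈ s, y i • f i = g := by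
  classical
  induction s using Finset.induction_on generalizing f g with
  | empty =>
    refine ⟨0, le_rfl, ?_⟩
    ext x
    have h₁ := h x (by simp)
    have h₂ := h (-x) (by simp)
    rw [map_neg] at h₂
    simp only [Finset.sum_empty, LinearMap.zero_apply]
    linarith
  | insert a s ha ih =>
    have sum_update (y : ι → 𝕜) (k : 𝕜) :
        ∑ i ∈ insert a s, Function.update y a k i • f i = k • f a + ∑ i ∈ s, y i • f i := by
      rw [Finset.sum_insert ha, Function.update_self]
      congr 1
      refine Finset.sum_congr rfl fun i hi => ?_
      rw [Function.update_of_ne (ne_of_mem_of_not_mem hi ha)]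
    by_cases hs : ∀ x, (∀ i ∈ s, f i x ≤ 0) → g x ≤ 0
    · obtain ⟨y, hy, rfl⟩ := ih f g hs
      refine ⟨Function.update y a 0, ?_, ?_⟩
      · exact le_update_iff.2 ⟨le_rfl, fun i _ => hy i⟩
      · rw [sum_update, zero_smul, zero_add]
    · push Not at hs
      obtain ⟨z, hz, hgz⟩ := hs
      have haz : 0 < f a z := by
        by_contra! hle
        exact hgz.not_ge (h z (by simpa [hle] using hz))
      -- Eliminate `f a` by projecting along `z` onto its kernel.
      obtain ⟨y, hy, hyg⟩ := ih (fun i => f i - (f i z / f a z) • f a)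
        (g - (g z / f a z) • f a) (fun x hx => by
          have key := h (x - (f a x / f a z) • z) (fun i hi => by
            rcases Finset.mem_insert.1 hi with rfl | hi
            · simp [haz.ne']
            · have := hx i hi
              simp only [LinearMap.sub_apply, LinearMap.smul_apply, smul_eq_mul, map_sub,
                map_smul] at this ⊢
              convert this using 2
              ring)
          simp only [LinearMap.sub_apply, LinearMap.smul_apply, smul_eq_mul, map_sub,
            map_smul] at key ⊢
          convert key using 2
          ring)
      refine ⟨Function.update y a (g z / f a z - ∑ i ∈ s, y i * (f i z / f a z)), ?_, ?_⟩
      · refine le_update_iff.2 ⟨sub_nonneg.2 ?_, fun i _ => hy i⟩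
        calc ∑ i ∈ s, y i * (f i z / f a z) ≤ 0 := Finset.sum_nonpos fun i hi =>
              mul_nonpos_of_nonneg_of_nonpos (hy i)
                (div_nonpos_of_nonpos_of_nonneg (hz i hi) haz.le)
          _ ≤ g z / f a z := (div_pos hgz haz).le
      · rw [sum_update]
        simp only [smul_sub, Finset.sum_sub_distrib, smul_smul, ← Finset.sum_smul] at hyg
        ext x
        have hx := LinearMap.congr_fun hyg x
        simp only [LinearMap.add_apply, LinearMap.sub_apply, LinearMap.smul_apply,
          smul_eq_mul] at hx ⊢
        linear_combination hx

/-- A lower bound `o` of `cᵀx` over a nonempty polyhedron `A x ≤ b` homogenizes to a bound on the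
cone `A x ≤ t b`, `t ≥ 0`. -/
theorem mul_le_dotProduct_of_mulVec_le_smul {n m : Type*} [Fintype n]
    {A : Matrix m n ℝ} {b : m → ℝ} {c : n → ℝ} {o : ℝ}
    (hne : ∃ x, A *ᵥ x ≤ b) (ho : ∀ x, A *ᵥ x ≤ b → o ≤ c ⬝ᵥ x)
    {x : n → ℝ} {t : ℝ} (ht : 0 ≤ t) (hx : A *ᵥ x ≤ t • b) : o * t ≤ c ⬝ᵥ x := by
  rcases ht.eq_or_lt with rfl | ht
  · obtain ⟨x₀, hx₀⟩ := hne
    rw [zero_smul] at hx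
    by_contra! hlt
    rw [mul_zero] at hlt
    have hray (r : ℝ) (hr : 0 ≤ r) : o ≤ c ⬝ᵥ x₀ + r * (c ⬝ᵥ x) := by
      have := ho (x₀ + r • x) (by
        rw [mulVec_add, mulVec_smul]
        simpa using add_le_add hx₀ (smul_nonpos_of_nonneg_of_nonpos hr hx))
      simpa [dotProduct_add, dotProduct_smul] using this
    have hr := hray ((c ⬝ᵥ x₀ - o + 1) / -(c ⬝ᵥ x))
      (div_nonneg (by linarith [ho x₀ hx₀]) (by linarith))
    have : (c ⬝ᵥ x₀ - o + 1) / -(c ⬝ᵥ x) * (c ⬝ᵥ x) = -(c ⬝ᵥ x₀ - o + 1) := by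
      have := hlt.ne
      field_simp
    linarith
  · have := ho (t⁻¹ • x) (by
      rw [mulVec_smul]
      exact (inv_smul_le_iff_of_pos ht).2 hx)
    rw [dotProduct_smul, smul_eq_mul, inv_mul_eq_div, le_div_iff₀ ht] at this
    exact this

/-- Strong LP duality in attained multiplier form: if the primal feasible set
`{x | A x ≤ b}` is nonempty and the infimum `o` of `cᵀx` over it is finite
(i.e. `o` is its greatest lower bound), then there is a dual multiplier `y ≥ 0`
with `Aᵀ y = -c` whose dual value `-bᵀy` equals `o`. -/
theorem strong_LP_duality_attained
    (n m : ℕ) (A : Matrix (Fin m) (Fin n) ℝ) (b : Fin m → ℝ) (c : Fin n → ℝ)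
    (hne : {x : Fin n → ℝ | A.mulVec x ≤ b}.Nonempty) (o : ℝ)
    (ho : IsGLB ((fun x => c ⬝ᵥ x) '' {x : Fin n → ℝ | A.mulVec x ≤ b}) o) :
    ∃ y : Fin m → ℝ, 0 ≤ y ∧ A.transpose.mulVec y = -c ∧ -(b ⬝ᵥ y) = o := by
  let fst := LinearMap.fst ℝ (Fin n → ℝ) ℝ
  let snd := LinearMap.snd ℝ (Fin n → ℝ) ℝ
  let f : Option (Fin m) → ((Fin n → ℝ) × ℝ) →ₗ[ℝ] ℝ := fun i =>
    i.elim (-snd) fun i => LinearMap.proj i ∘ₗ A.mulVecLin ∘ₗ fst - b i • snd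
  let g : ((Fin n → ℝ) × ℝ) →ₗ[ℝ] ℝ := o • snd - dotProductBilin ℝ ℝ c ∘ₗ fst
  obtain ⟨y, hy, hyg⟩ := exists_nonneg_sum_smul_eq_of_forall_nonpos Finset.univ f g (by
    rintro ⟨x, t⟩ hx
    have ht : 0 ≤ t := by simpa [f, snd] using hx none (Finset.mem_univ _)
    have hAx : A *ᵥ x ≤ t • b := fun i => by
      simpa [f, fst, snd, mul_comm] using hx (some i) (Finset.mem_univ _)
    simpa [g, fst, snd] using mul_le_dotProduct_of_mulVec_le_smul hne
      (fun x hx => ho.1 (Set.mem_image_of_mem _ hx)) ht hAx)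
  have combination_apply (x : Fin n → ℝ) (t : ℝ) :
      -(y none * t) + ∑ i, y (some i) * ((A *ᵥ x) i - b i * t) = o * t - c ⬝ᵥ x := by
    simpa [f, g, fst, snd, Fintype.sum_option] using LinearMap.congr_fun hyg (x, t)
  have hdual : Aᵀ *ᵥ (fun i => y (some i)) = -c := by
    refine dotProduct_eq _ _ fun x => ?_
    have := combination_apply x 0
    simp only [mul_zero, neg_zero, zero_add, sub_zero, zero_sub] at this
    rw [mulVec_transpose, ← dotProduct_mulVec, neg_dotProduct]
    exact this
  refine ⟨fun i => y (some i), fun i => hy _, hdual, le_antisymm (ho.2 ?_) ?_⟩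
  · rintro _ ⟨x, hx, rfl⟩
    have hle : (fun i => y (some i)) ⬝ᵥ (A *ᵥ x) ≤ (fun i => y (some i)) ⬝ᵥ b :=
      dotProduct_le_dotProduct_of_nonneg_left hx fun i => hy _
    rw [dotProduct_mulVec, ← mulVec_transpose, hdual, neg_dotProduct, dotProduct_comm _ b] at hle
    simpa using neg_le.1 hle
  · have hval := combination_apply 0 1
    have hnone : 0 ≤ y none := hy none
    have hb : ∑ i, y (some i) * ((A *ᵥ 0) i - b i * 1) = -(b ⬝ᵥ fun i => y (some i)) := by
      simp [dotProduct, mul_comm]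
    rw [hb, dotProduct_zero] at hval
    linarith
end

section
/- Partial-dualization strong duality over a compact box: Let l, u ∈ ℝ^n with l ≤ u componentwise and let K = {v ∈ ℝ^n | l ≤ v ≤ u} be the corresponding compact box. Let A ∈ ℝ^{m×n}, b ∈ ℝ^m, c ∈ ℝ^n, and suppose the set {v ∈ K | A v ≤ b} is nonempty. Then sup over λ ∈ ℝ^m with λ ≥ 0 of (inf over v ∈ K of cᵀv + λᵀ(A v − b)) equals the minimum of cᵀv over {v ∈ K | A v ≤ b}. -/
open Matrix

/-- Every value strictly below the constrained minimum `r` of a linear objective over a compact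
convex set is a lower bound of the Lagrangian for some nonnegative multiplier. -/
theorem exists_multiplier_of_lt_constrained_min {n m : ℕ} {K : Set (Fin n → ℝ)}
    (hK : IsCompact K) (hconv : Convex ℝ K)
    (A : Matrix (Fin m) (Fin n) ℝ) (b : Fin m → ℝ) (c : Fin n → ℝ) {r q : ℝ}
    (hr : IsLeast ((fun v => c ⬝ᵥ v) '' {v | v ∈ K ∧ A *ᵥ v ≤ b}) r) (hq : q < r) :
    ∃ lam : Fin m → ℝ, 0 ≤ lam ∧ ∀ v ∈ K, q ≤ c ⬝ᵥ v + lam ⬝ᵥ (A *ᵥ v - b) := by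
  obtain ⟨⟨w, ⟨hwK, hwb⟩, hwr⟩, hmin⟩ := hr
  let L : (Fin n → ℝ) →ₗ[ℝ] (Fin m → ℝ) × ℝ := A.mulVecLin.prod (dotProductBilin ℝ ℝ c)
  have hL (v) : L v = (A *ᵥ v, c ⬝ᵥ v) := rfl
  have hdisj : Disjoint (L '' K) (Set.Iic (b, q)) := by
    rw [Set.disjoint_left]
    rintro _ ⟨v, hv, rfl⟩ hle
    have h : A *ᵥ v ≤ b ∧ c ⬝ᵥ v ≤ q := hle
    have := hmin ⟨v, ⟨hv, h.1⟩, rfl⟩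
    dsimp only at this
    linarith [h.2]
  obtain ⟨F, s, t, hs, hst, ht⟩ := geometric_hahn_banach_compact_closed
    (hconv.linear_image L) (hK.image L.continuous_of_finiteDimensional)
    (convex_Iic (𝕜 := ℝ) (b, q)) isClosed_Iic hdisj
  let p : Fin m → ℝ := fun i => -F (Pi.single i 1, 0)
  let g : ℝ := -F (0, 1)
  have hF (z : Fin m → ℝ) (a : ℝ) : F (z, a) = -(p ⬝ᵥ z) - g * a := by
    have hz : F (z, 0) = -(p ⬝ᵥ z) := by
      have h := LinearMap.pi_apply_eq_sum_univ
        (F.toLinearMap ∘ₗ LinearMap.inl ℝ (Fin m → ℝ) ℝ) z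
      simp only [LinearMap.comp_apply, LinearMap.inl_apply, ContinuousLinearMap.coe_coe,
        smul_eq_mul] at h
      rw [h, dotProduct, ← Finset.sum_neg_distrib]
      refine Finset.sum_congr rfl fun i _ => ?_
      have : (fun j => if i = j then (1 : ℝ) else 0) = Pi.single i 1 := by
        ext j
        simp [Pi.single_apply, eq_comm]
      rw [this]
      ring
    have ha : F (0, a) = -(g * a) := by
      have h := F.map_smul a (0, 1)
      simp only [Prod.smul_mk, smul_zero, smul_eq_mul, mul_one] at h
      rw [h]
      ring
    have h := F.map_add (z, 0) (0, a)
    simp only [Prod.mk_add_mk, add_zero, zero_add] at h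
    rw [h, hz, ha]
    ring
  have hp : 0 ≤ p := by
    intro i
    by_contra! hi
    change p i < 0 at hi
    have hbq := ht (b, q) (Set.mem_Iic.2 le_rfl)
    have hk : 0 ≤ (F (b, q) - t) / -p i := div_nonneg (by linarith) (by linarith)
    have h := ht (b - Pi.single i ((F (b, q) - t) / -p i), q)
      (Set.mem_Iic.2 ⟨sub_le_self _ (Pi.single_nonneg.2 hk), le_rfl⟩)
    have hmul : p i * ((F (b, q) - t) / -p i) = -(F (b, q) - t) := by
      field_simp [hi.ne]
    rw [hF, dotProduct_sub, dotProduct_single, hmul] at h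
    linarith [hF b q]
  have hlow (v) (hv : v ∈ K) : g * q < g * (c ⬝ᵥ v) + p ⬝ᵥ (A *ᵥ v - b) := by
    have h₁ := hs _ ⟨v, hv, rfl⟩
    have h₂ := ht (b, q) (Set.mem_Iic.2 le_rfl)
    rw [hL, hF] at h₁
    rw [hF] at h₂
    rw [dotProduct_sub]
    linarith
  have hg : 0 < g := by
    have h₁ := hlow w hwK
    have h₂ : p ⬝ᵥ (A *ᵥ w) ≤ p ⬝ᵥ b := dotProduct_le_dotProduct_of_nonneg_left hwb hp
    dsimp only at hwr
    rw [dotProduct_sub, hwr] at h₁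
    exact pos_of_mul_pos_left (b := r - q) (by linarith) (by linarith)
  refine ⟨g⁻¹ • p, smul_nonneg (inv_nonneg.2 hg.le) hp, fun v hv => ?_⟩
  rw [smul_dotProduct, smul_eq_mul]
  refine le_of_mul_le_mul_left ?_ hg
  rw [mul_add, mul_inv_cancel_left₀ hg.ne']
  exact (hlow v hv).le

/-- Partial-dualization strong duality over a compact box: for a nonempty feasible set
`{v ∈ [l,u] | A v ≤ b}`, the supremum over `λ ≥ 0` of the box-constrained Lagrangian
dual function equals the minimum of `cᵀv` over the feasible set (which is attained). -/
theorem partial_dualization_strong_duality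
    (n m : ℕ) (l u : Fin n → ℝ) (hlu : l ≤ u)
    (A : Matrix (Fin m) (Fin n) ℝ) (b : Fin m → ℝ) (c : Fin n → ℝ)
    (hne : {v : Fin n → ℝ | v ∈ Set.Icc l u ∧ A.mulVec v ≤ b}.Nonempty) :
    ∃ r : ℝ,
      IsLeast ((fun v => c ⬝ᵥ v) '' {v : Fin n → ℝ | v ∈ Set.Icc l u ∧ A.mulVec v ≤ b}) r ∧
      (⨆ lam ∈ {lam : Fin m → ℝ | 0 ≤ lam},
          ⨅ v ∈ Set.Icc l u, ((c ⬝ᵥ v + lam ⬝ᵥ (A.mulVec v - b) : ℝ) : EReal))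
        = (r : EReal) := by
  have hcont : Continuous fun v : Fin n → ℝ => c ⬝ᵥ v := by fun_prop
  have hclosed : IsClosed {v : Fin n → ℝ | A.mulVec v ≤ b} :=
    isClosed_le (by fun_prop) continuous_const
  have hcompact : IsCompact {v : Fin n → ℝ | v ∈ Set.Icc l u ∧ A.mulVec v ≤ b} :=
    isCompact_Icc.inter_right hclosed
  obtain ⟨r, hr⟩ := (hcompact.image hcont).exists_isLeast (hne.image _)
  refine ⟨r, hr, le_antisymm ?_ ?_⟩
  · obtain ⟨w, ⟨hwK, hwb⟩, hwr⟩ := hr.1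
    dsimp only at hwr
    refine iSup₂_le fun lam hlam => iInf₂_le_of_le w hwK (EReal.coe_le_coe_iff.2 ?_)
    have := dotProduct_le_dotProduct_of_nonneg_left hwb hlam
    rw [dotProduct_sub, hwr]
    linarith
  · refine le_of_forall_lt fun x hx => ?_
    obtain ⟨q, hxq, hqr⟩ := EReal.lt_iff_exists_real_btwn.1 hx
    obtain ⟨lam, hlam, h⟩ := exists_multiplier_of_lt_constrained_min isCompact_Icc
      (convex_Icc l u) A b c hr (EReal.coe_lt_coe_iff.1 hqr)
    exact hxq.trans_le (le_iSup₂_of_le lam hlam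
      (le_iInf₂ fun v hv => EReal.coe_le_coe_iff.2 (h v hv)))
end
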